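/- Let f = (f_n) be a uniformly computable ensemble of functions f_n : {0,1}^n × {0,1}^n → {0,1}^{m(n)}. Then there is a constant c such that for every n and every positive integer α with α ≤ m(n) and α ≤ n, there exists a pair (x,y) ∈ {0,1}^n × {0,1}^n with C(x|n) ≥ n − α − c·log₂ n, C(y|n) ≥ n − α − c·log₂ n, dep(x,y) ≤ α + c·log₂ n, and C(f_n(x,y) | n) ≤ m(n) − α + 2·log₂ α + c; in particular the randomness deficiency m(n) − C(f_n(x,y)|n) of the output is at least α − 2·log₂ α − c on some input pair of complexity at least n − α − c·log₂ n and dependency at most α + c·log₂ n. -/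

import Mathlib

/-- Binary strings. -/
abbrev Str := List Bool

/-- `U` is an optimal universal conditional machine: it is partial computable and,
for every partial computable `M`, programs for `M` can be translated to programs
for `U` with only a constant-length overhead. -/
def UniversalM (U : Str × Str →. Str) : Prop :=
  Partrec U ∧
    ∀ M : Str × Str →. Str, Partrec M →
      ∃ c : ℕ, ∀ x y p : Str, x ∈ M (p, y) →
        ∃ q : Str, x ∈ U (q, y) ∧ q.length ≤ p.length + c

/-- Conditional plain Kolmogorov complexity `C(x|y)` with respect to `U`. -/
noncomputable def KC (U : Str × Str →. Str) (x y : Str) : ℕ :=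
  sInf {l : ℕ | ∃ p : Str, p.length = l ∧ x ∈ U (p, y)}

/-- Unconditional plain complexity `C(x) = C(x|λ)`. -/
noncomputable def KC0 (U : Str × Str →. Str) (x : Str) : ℕ := KC U x []

/-- Complexity conditioned on (the binary representation of) a natural number. -/
noncomputable def KCn (U : Str × Str →. Str) (x : Str) (n : ℕ) : ℕ := KC U x (Nat.bits n)

/-- The dependency `dep(x,y)` of two strings of length `n`. -/
noncomputable def dep (U : Str × Str →. Str) (n : ℕ) (x y : Str) : ℤ :=
  max ((KCn U x n : ℤ) - (KC U x y : ℤ)) ((KCn U y n : ℤ) - (KC U y x : ℤ))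

section Search

variable {α β σ : Type*} [Primcodable α] [Primcodable β] [Primcodable σ]

/-- The number of indices below `N` that encode an element satisfying `p`. -/
def countCodes (p : α → Bool) (N : ℕ) : ℕ :=
  N.rec 0 fun i s => s + (((Encodable.decode₂ α i).map p).getD false).toNat

theorem computable_countCodes {p : β → α → Bool} (hp : Computable₂ p) :
    Computable₂ fun b N => countCodes (p b) N := by
  refine Computable.nat_rec Computable.snd (Computable.const 0)
    (h := fun (a : β × ℕ) (q : ℕ × ℕ) =>
      q.2 + (((Encodable.decode₂ α q.1).map (p a.1)).getD false).toNat) ?_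
  refine Primrec.nat_add.to_comp.comp (Computable.snd.comp Computable.snd) ?_
  refine (Primrec.dom_bool Bool.toNat).to_comp.comp ?_
  refine Computable.option_getD (Computable.option_map ?_ ?_) (Computable.const false)
  · exact Primrec.decode₂.to_comp.comp (Computable.fst.comp Computable.snd)
  · exact hp.comp (Computable.fst.comp (Computable.fst.comp Computable.fst)) Computable.snd

theorem countCodes_eq_card (p : α → Bool) (N : ℕ) :
    ∃ s : Finset α, s.card = countCodes p N ∧
      ∀ a, a ∈ s ↔ p a = true ∧ Encodable.encode a < N := by
  classical
  induction N with
  | zero => exact ⟨∅, rfl, by simp⟩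
  | succ N ih =>
    obtain ⟨s, hs, hmem⟩ := ih
    change ∃ t : Finset α, t.card = countCodes p N +
      (((Encodable.decode₂ α N).map p).getD false).toNat ∧ _
    have key : ∀ a : α, Encodable.encode a < N + 1 ↔
        Encodable.encode a < N ∨ Encodable.decode₂ α N = some a := fun a => by
      rw [Encodable.decode₂_eq_some]; omega
    rcases hd : Encodable.decode₂ α N with - | a
    · exact ⟨s, by simpa using hs, fun b => by simp [hmem, key, hd]⟩
    · have ha : Encodable.encode a = N := Encodable.decode₂_eq_some.1 hd
      cases hpa : p a with
      | false =>
        refine ⟨s, by simpa [hpa] using hs, fun b => ?_⟩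
        rw [hmem, key, hd]
        grind
      | true =>
        refine ⟨insert a s, ?_, fun b => ?_⟩
        · rw [Finset.card_insert_of_notMem (by simp [hmem, ha])]
          simp [hpa, hs]
        · rw [Finset.mem_insert, hmem, key, hd]
          grind

/-- Given a computable family of predicates indexed by `σ`, one can search for an index whose
predicate is satisfied by at least `T` elements. -/
theorem exists_partrec_search {p : β × σ → α → Bool} (hp : Computable₂ p)
    {T : β → ℕ} (hT : Computable T) :
    ∃ R : β →. σ, Partrec R ∧
      (∀ b, ∀ u ∈ R b, ∃ s : Finset α, T b ≤ s.card ∧ ∀ a ∈ s, p (b, u) a = true) ∧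
      ∀ b u, ∀ s : Finset α, T b ≤ s.card → (∀ a ∈ s, p (b, u) a = true) → (R b).Dom := by
  let g : β → ℕ → Option σ := fun b i => (Encodable.decode (α := σ × ℕ) i).bind fun q =>
    bif decide (T b ≤ countCodes (p (b, q.1)) q.2) then some q.1 else none
  have hg : Computable₂ g := by
    refine Computable.option_bind (Computable.decode.comp Computable.snd) ?_
    have hb : Computable fun x : (β × ℕ) × (σ × ℕ) => x.1.1 :=
      Computable.fst.comp Computable.fst
    have hu : Computable fun x : (β × ℕ) × (σ × ℕ) => x.2.1 :=
      Computable.fst.comp Computable.snd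
    refine Computable.cond (Primrec.nat_le.decide.to_comp.comp (hT.comp hb) ?_)
      (Computable.option_some.comp hu) (Computable.const none)
    exact (computable_countCodes hp).comp (hb.pair hu) (Computable.snd.comp Computable.snd)
  refine ⟨fun b => Nat.rfindOpt (g b), Partrec.rfindOpt hg, fun b u hu => ?_, fun b u s hs hps => ?_⟩
  · obtain ⟨i, hi⟩ := Nat.rfindOpt_spec hu
    obtain ⟨⟨v, N⟩, -, hv⟩ := Option.bind_eq_some_iff.1 hi
    obtain ⟨s, hs, hmem⟩ := countCodes_eq_card (p (b, v)) N
    by_cases h : T b ≤ countCodes (p (b, v)) N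
    · obtain rfl : v = u := by simpa [h] using hv
      exact ⟨s, hs ▸ h, fun a ha => ((hmem a).1 ha).1⟩
    · simp [h] at hv
  · refine Nat.rfindOpt_dom.2
      ⟨Encodable.encode (u, s.sup Encodable.encode + 1), u, ?_⟩
    obtain ⟨t, ht, hmem⟩ := countCodes_eq_card (p (b, u)) (s.sup Encodable.encode + 1)
    have hst : s ⊆ t := fun a ha =>
      (hmem a).2 ⟨hps a ha, Nat.lt_succ_of_le (Finset.le_sup (f := Encodable.encode) ha)⟩
    have hle : T b ≤ countCodes (p (b, u)) (s.sup Encodable.encode + 1) :=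
      hs.trans (ht ▸ Finset.card_le_card hst)
    simp [g, hle]

end Search

theorem primrec_two_pow : Primrec fun n : ℕ => 2 ^ n :=
  (Primrec.nat_rec₁ (f := fun _ s => 2 * s) 1
    (Primrec.nat_double.comp₂ Primrec₂.right)).of_eq fun n => by
      induction n with
      | zero => rfl
      | succ n ih => rw [pow_succ', ← ih]

/-- The natural number with the given binary digits, least significant first. -/
def ofBits (l : Str) : ℕ := l.foldr Nat.bit 0

theorem ofBits_bits (n : ℕ) : ofBits n.bits = n := by
  induction n using Nat.binaryRec' with
  | zero => simp [ofBits]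
  | bit b n h ih => rw [Nat.bits_append_bit _ _ h, ofBits, List.foldr_cons, ← ofBits, ih]

theorem primrec_ofBits : Primrec ofBits := by
  refine Primrec.list_foldr (h := fun _ q => Nat.bit q.1 q.2) Primrec.id (Primrec.const 0) ?_
  exact (Primrec.cond (Primrec.fst.comp Primrec.snd)
    (Primrec.nat_double_succ.comp (Primrec.snd.comp Primrec.snd))
    (Primrec.nat_double.comp (Primrec.snd.comp Primrec.snd))).of_eq
      fun q => by cases h : q.2.1 <;> simp [Nat.bit, h]

/-- The binary strings of length `n`. -/
noncomputable def strs (n : ℕ) : Finset Str := (List.finite_length_eq Bool n).toFinset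

@[simp]
theorem mem_strs {n : ℕ} {x : Str} : x ∈ strs n ↔ x.length = n := by simp [strs]

theorem card_strs (n : ℕ) : (strs n).card = 2 ^ n := by
  have h : Nat.card {l : Str // l.length = n} = 2 ^ n := by
    have := card_vector (α := Bool) n
    rw [Fintype.card_bool, ← Nat.card_eq_fintype_card] at this
    exact this
  rw [← h, strs, ← Set.ncard_eq_toFinset_card _ (List.finite_length_eq Bool n)]
  rfl

section Complexity

variable {U : Str × Str →. Str}

theorem KC_le {x y p : Str} (h : x ∈ U (p, y)) : KC U x y ≤ p.length :=
  Nat.sInf_le ⟨p, rfl, h⟩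

theorem UniversalM.exists_le_length (hU : UniversalM U) {M : Str × Str →. Str} (hM : Partrec M) :
    ∃ c : ℕ, ∀ x y p : Str, x ∈ M (p, y) → KC U x y ≤ p.length + c := by
  obtain ⟨c, hc⟩ := hU.2 M hM
  refine ⟨c, fun x y p h => ?_⟩
  obtain ⟨q, hq, hl⟩ := hc x y p h
  exact (KC_le hq).trans hl

theorem partrec_fst : Partrec (fun q : Str × Str => Part.some q.1) := Computable.fst

theorem UniversalM.exists_program (hU : UniversalM U) (x y : Str) :
    ∃ p : Str, p.length = KC U x y ∧ x ∈ U (p, y) := by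
  obtain ⟨c, hc⟩ := hU.2 _ partrec_fst
  obtain ⟨q, hq, -⟩ := hc x y x (Part.mem_some _)
  exact Nat.sInf_mem (s := {l : ℕ | ∃ p : Str, p.length = l ∧ x ∈ U (p, y)}) ⟨_, q, rfl, hq⟩

theorem UniversalM.card_lt_two_pow (hU : UniversalM U) (y : Str) (L : ℕ) (s : Finset Str)
    (hs : ∀ x ∈ s, KC U x y < L) : s.card < 2 ^ L := by
  choose prog hlen hprog using fun x => hU.exists_program x y
  calc s.card ≤ ((Finset.range L).biUnion strs).card := by
        refine Finset.card_le_card_of_injOn prog (fun x hx => ?_) fun x _ x' _ h => ?_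
        · simpa [hlen] using hs x hx
        · exact Part.mem_unique (hprog x) (h ▸ hprog x')
    _ ≤ ∑ i ∈ Finset.range L, 2 ^ i :=
        Finset.card_biUnion_le.trans_eq (Finset.sum_congr rfl fun i _ => card_strs i)
    _ < 2 ^ L := Nat.geomSum_lt le_rfl fun i hi => Finset.mem_range.1 hi

/-- There are at most `2 ^ (2 * n - α) / 8` pairs `q` for which `g q` has complexity below `n - α - 3`
given `e q`. Here `g` and `h` are meant to be the two projections, and `e q` depends on `h q` only. -/
theorem UniversalM.card_pairs_le (hU : UniversalM U) {n α : ℕ} (hα : α ≤ n)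
    (s : Finset (Str × Str)) (g h e : Str × Str → Str)
    (hgh : ∀ q q', g q = g q' → h q = h q' → q = q')
    (hh : ∀ q ∈ s, (h q).length = n) (he : ∀ q q', h q = h q' → e q = e q')
    (hs : ∀ q ∈ s, KC U (g q) (e q) + α + 3 < n) :
    8 * s.card ≤ 2 ^ (2 * n - α) := by
  classical
  rcases s.eq_empty_or_nonempty with rfl | ⟨q₀, hq₀⟩
  · simp
  have hn := hs q₀ hq₀
  have hfib : ∀ y ∈ strs n, (s.filter fun q => h q = y).card ≤ 2 ^ (n - α - 3) := by
    intro y _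
    rcases (s.filter fun q => h q = y).eq_empty_or_nonempty with h0 | ⟨q₁, hq₁⟩
    · simp [h0]
    rw [Finset.mem_filter] at hq₁
    rw [← Finset.card_image_of_injOn (f := g) fun q hq q' hq' hg => hgh q q' hg ?_]
    · refine (hU.card_lt_two_pow (e q₁) _ _ fun x hx => ?_).le
      obtain ⟨q, hq, rfl⟩ := Finset.mem_image.1 hx
      rw [Finset.mem_filter] at hq
      rw [← he q q₁ (hq.2.trans hq₁.2.symm)]
      have := hs q hq.1
      omega
    · exact (Finset.mem_filter.1 hq).2.trans (Finset.mem_filter.1 hq').2.symm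
  have hcard := Finset.card_le_mul_card_image_of_maps_to
    (fun q hq => mem_strs.2 (hh q hq)) _ hfib
  rw [card_strs] at hcard
  calc 8 * s.card ≤ 2 ^ 3 * (2 ^ (n - α - 3) * 2 ^ n) := by omega
    _ = 2 ^ (2 * n - α) := by
      rw [← pow_add, ← pow_add]
      congr 1
      omega

/-- Many pairs have neither coordinate of low complexity, be it conditioned on the length or
on the other coordinate. -/
theorem UniversalM.exists_pair (hU : UniversalM U) {n α : ℕ} (hα : α ≤ n)
    (s : Finset (Str × Str)) (hlen : ∀ q ∈ s, q.1.length = n ∧ q.2.length = n)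
    (hs : 2 ^ (2 * n - α) ≤ s.card) :
    ∃ q ∈ s, n ≤ KCn U q.1 n + α + 3 ∧ n ≤ KCn U q.2 n + α + 3 ∧
      n ≤ KC U q.1 q.2 + α + 3 ∧ n ≤ KC U q.2 q.1 + α + 3 := by
  classical
  by_contra! hcon
  let bad (g e : Str × Str → Str) := s.filter fun q => KC U (g q) (e q) + α + 3 < n
  have hbad₁ (e : Str × Str → Str) (he : ∀ q q' : Str × Str, q.2 = q'.2 → e q = e q') :
      8 * (bad Prod.fst e).card ≤ 2 ^ (2 * n - α) :=
    hU.card_pairs_le hα _ _ Prod.snd e (fun _ _ => Prod.ext)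
      (fun q hq => (hlen q (Finset.mem_filter.1 hq).1).2) he
      fun q hq => (Finset.mem_filter.1 hq).2
  have hbad₂ (e : Str × Str → Str) (he : ∀ q q' : Str × Str, q.1 = q'.1 → e q = e q') :
      8 * (bad Prod.snd e).card ≤ 2 ^ (2 * n - α) :=
    hU.card_pairs_le hα _ _ Prod.fst e (fun _ _ h₂ h₁ => Prod.ext h₁ h₂)
      (fun q hq => (hlen q (Finset.mem_filter.1 hq).1).1) he
      fun q hq => (Finset.mem_filter.1 hq).2
  have h₁ := hbad₁ (fun _ => n.bits) fun _ _ _ => rfl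
  have h₂ := hbad₂ (fun _ => n.bits) fun _ _ _ => rfl
  have h₃ := hbad₁ Prod.snd fun _ _ h => h
  have h₄ := hbad₂ Prod.fst fun _ _ h => h
  have hcover : s ⊆ (bad Prod.fst fun _ => n.bits) ∪ (bad Prod.snd fun _ => n.bits) ∪
      bad Prod.fst Prod.snd ∪ bad Prod.snd Prod.fst := fun q hq => by
    have := hcon q hq
    simp only [bad, Finset.mem_union, Finset.mem_filter, hq, true_and]
    by_contra! h
    exact (this h.1.1.1 h.1.1.2 h.1.2).not_ge h.2
  have hle := (Finset.card_le_card hcover).trans <| (Finset.card_union_le _ _).trans <|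
    Nat.add_le_add_right ((Finset.card_union_le _ _).trans <|
      Nat.add_le_add_right (Finset.card_union_le _ _) _) _
  have := Nat.two_pow_pos (2 * n - α)
  omega

end Complexity

section Ensemble

variable {m : ℕ → ℕ} {f : ℕ → Str → Str → Str}

theorem computable_outputLength
    (hcomp : Computable fun p : ℕ × Str × Str => f p.1 p.2.1 p.2.2)
    (hlen : ∀ n (x y : Str), x.length = n → y.length = n → (f n x y).length = m n) :
    Computable m := by
  have hrep : Computable fun n : ℕ => (List.range n).map fun _ => false :=
    (Primrec.list_map Primrec.list_range (Primrec.const false).to₂).to_comp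
  exact (Computable.list_length.comp (hcomp.comp (Computable.id.pair (hrep.pair hrep)))).of_eq
    fun n => hlen n _ _ (by simp) (by simp)

/-- Some machine maps strings of length `m n - α` to outputs of `f n`, in such a way that at least a
`2⁻ᵅ` fraction of all input pairs have their output in the range. -/
theorem exists_machine
    (hcomp : Computable fun p : ℕ × Str × Str => f p.1 p.2.1 p.2.2)
    (hlen : ∀ n (x y : Str), x.length = n → y.length = n → (f n x y).length = m n) :
    ∃ M : Str × Str →. Str, Partrec M ∧ ∀ n α, α ≤ m n → α ≤ n →
      ∃ s : Finset (Str × Str), 2 ^ (2 * n - α) ≤ s.card ∧ ∀ q ∈ s,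
        q.1.length = n ∧ q.2.length = n ∧
          ∃ w : Str, w.length = m n - α ∧ f n q.1 q.2 ∈ M (w, n.bits) := by
  have hm := computable_outputLength hcomp hlen
  let p : (ℕ × ℕ) × Str → Str × Str → Bool := fun b q =>
    decide (q.1.length = b.1.1) && (decide (q.2.length = b.1.1) &&
      decide ((f b.1.1 q.1 q.2).drop b.1.2 = b.2))
  have hp : Computable₂ p := by
    have hn : Computable fun z : ((ℕ × ℕ) × Str) × Str × Str => z.1.1.1 :=
      Computable.fst.comp (Computable.fst.comp Computable.fst)
    have hk : Computable fun z : ((ℕ × ℕ) × Str) × Str × Str => z.1.1.2 :=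
      Computable.snd.comp (Computable.fst.comp Computable.fst)
    have hu : Computable fun z : ((ℕ × ℕ) × Str) × Str × Str => z.1.2 :=
      Computable.snd.comp Computable.fst
    have hx : Computable fun z : ((ℕ × ℕ) × Str) × Str × Str => z.2.1 :=
      Computable.fst.comp Computable.snd
    have hy : Computable fun z : ((ℕ × ℕ) × Str) × Str × Str => z.2.2 :=
      Computable.snd.comp Computable.snd
    have hinput : Computable fun z : ((ℕ × ℕ) × Str) × Str × Str => (z.1.1.1, z.2.1, z.2.2) :=
      hn.pair Computable.snd
    have hf := hcomp.comp hinput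
    dsimp only at hf
    have hex : Computable fun z : ((ℕ × ℕ) × Str) × Str × Str =>
        decide (z.2.1.length = z.1.1.1) :=
      (Primrec.eq (α := ℕ)).decide.to_comp.comp (Computable.list_length.comp hx) hn
    have hey : Computable fun z : ((ℕ × ℕ) × Str) × Str × Str =>
        decide (z.2.2.length = z.1.1.1) :=
      (Primrec.eq (α := ℕ)).decide.to_comp.comp (Computable.list_length.comp hy) hn
    have hef : Computable fun z : ((ℕ × ℕ) × Str) × Str × Str =>
        decide ((f z.1.1.1 z.2.1 z.2.2).drop z.1.1.2 = z.1.2) :=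
      (Primrec.eq (α := Str)).decide.to_comp.comp
        ((Primrec.list_drop (α := Bool)).to_comp.comp hk hf) hu
    exact Primrec.and.to_comp.comp hex (Primrec.and.to_comp.comp hey hef)
  have hT : Computable fun b : ℕ × ℕ => 2 ^ (2 * b.1 - (m b.1 - b.2)) :=
    primrec_two_pow.to_comp.comp <| Primrec.nat_sub.to_comp.comp
      (Primrec.nat_double.to_comp.comp Computable.fst)
      (Primrec.nat_sub.to_comp.comp (hm.comp Computable.fst) Computable.snd)
  obtain ⟨R, hR, hRmem, hRdom⟩ := exists_partrec_search hp hT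
  refine ⟨fun z => (R (ofBits z.2, z.1.length)).map fun u => z.1 ++ u, ?_, fun n α hαm hαn => ?_⟩
  · refine Partrec.map (hR.comp ?_) ?_
    · exact (primrec_ofBits.to_comp.comp Computable.snd).pair
        (Computable.list_length.comp Computable.fst)
    · exact Computable.list_append.comp (Computable.fst.comp Computable.fst) Computable.snd
  have hk : m n - (m n - α) = α := by omega
  have hdom : (R (n, m n - α)).Dom := by
    obtain ⟨u, -, hu⟩ := Finset.exists_le_card_fiber_of_mul_le_card_of_maps_to
      (s := strs n ×ˢ strs n) (t := strs α) (n := 2 ^ (2 * n - α))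
      (f := fun q => (f n q.1 q.2).drop (m n - α))
      (fun q hq => by
        rw [Finset.mem_product, mem_strs, mem_strs] at hq
        rw [mem_strs, List.length_drop, hlen n _ _ hq.1 hq.2, hk])
      ⟨List.replicate α false, by simp⟩
      (by
        rw [Finset.card_product, card_strs, card_strs, ← pow_add, ← pow_add]
        exact Nat.pow_le_pow_right two_pos (by omega))
    refine hRdom _ u _ (by simpa only [hk] using hu) fun q hq => ?_
    simpa [p, and_assoc] using hq
  obtain ⟨s, hs, hps⟩ := hRmem _ _ (Part.get_mem hdom)
  simp only [hk] at hs
  refine ⟨s, hs, fun q hq => ?_⟩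
  have hq' := hps q hq
  simp only [p, Bool.and_eq_true, decide_eq_true_eq] at hq'
  obtain ⟨hx, hy, hu⟩ := hq'
  have hw : ((f n q.1 q.2).take (m n - α)).length = m n - α := by
    rw [List.length_take, hlen n _ _ hx hy]
    omega
  refine ⟨hx, hy, _, hw, (Part.mem_map_iff _).2 ⟨_, ?_, List.take_append_drop (m n - α) _⟩⟩
  rw [hw, ofBits_bits, hu]
  exact Part.get_mem hdom

end Ensemble

/-- no computable two-source ensemble can have randomness deficiency
of the output below (roughly) the dependency of the inputs. -/
theorem stmt3 (U : Str × Str →. Str) (hU : UniversalM U)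
    (m : ℕ → ℕ) (f : ℕ → Str → Str → Str)
    (hcomp : Computable (fun p : ℕ × Str × Str => f p.1 p.2.1 p.2.2))
    (hlen : ∀ n (x y : Str), x.length = n → y.length = n → (f n x y).length = m n) :
    ∃ c : ℝ, 0 ≤ c ∧ ∀ n α : ℕ, 0 < α → α ≤ m n → α ≤ n →
      ∃ x y : Str, x.length = n ∧ y.length = n ∧
        (n : ℝ) - (α : ℝ) - c * Real.logb 2 n ≤ (KCn U x n : ℝ) ∧
        (n : ℝ) - (α : ℝ) - c * Real.logb 2 n ≤ (KCn U y n : ℝ) ∧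
        ((dep U n x y : ℤ) : ℝ) ≤ (α : ℝ) + c * Real.logb 2 n ∧
        (KCn U (f n x y) n : ℝ) ≤ (m n : ℝ) - (α : ℝ) + 2 * Real.logb 2 α + c := by
  obtain ⟨M, hM, hMs⟩ := exists_machine hcomp hlen
  obtain ⟨c₁, hc₁⟩ := hU.exists_le_length hM
  obtain ⟨c₂, hc₂⟩ := hU.exists_le_length partrec_fst
  set c₀ := KCn U (f 1 [true] [true]) 1
  refine ⟨c₀ + c₁ + c₂ + 3, by positivity, fun n α hα hαm hαn => ?_⟩
  have hlogα : 0 ≤ Real.logb 2 α :=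
    Real.logb_nonneg one_lt_two (by exact_mod_cast hα)
  have hαm' : (α : ℝ) ≤ m n := by exact_mod_cast hαm
  have hnn : (0 : ℝ) ≤ c₀ ∧ (0 : ℝ) ≤ c₁ ∧ (0 : ℝ) ≤ c₂ :=
    ⟨Nat.cast_nonneg _, Nat.cast_nonneg _, Nat.cast_nonneg _⟩
  obtain ⟨h₀, h₁, h₂⟩ := hnn
  rcases (by omega : n = 1 ∨ 2 ≤ n) with rfl | hn
  · obtain rfl : α = 1 := by omega
    have hdep : dep U 1 [true] [true] = 0 := by
      simp [dep, KCn, Nat.one_bits]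
    refine ⟨[true], [true], rfl, rfl, ?_, ?_, ?_, ?_⟩
    · simp
    · simp
    · simp [hdep]
    · change (c₀ : ℝ) ≤ _
      linarith
  · have hlog : 1 ≤ Real.logb 2 n := by
      rw [Real.le_logb_iff_rpow_le one_lt_two (by positivity), Real.rpow_one]
      exact_mod_cast hn
    have hc : (c₀ + c₁ + c₂ + 3 : ℝ) ≤ (c₀ + c₁ + c₂ + 3) * Real.logb 2 n :=
      le_mul_of_one_le_right (by positivity) hlog
    obtain ⟨s, hs, hsM⟩ := hMs n α hαm hαn
    obtain ⟨⟨x, y⟩, hq, hxn, hyn, hxy, hyx⟩ :=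
      hU.exists_pair hαn s (fun q hq => ⟨(hsM q hq).1, (hsM q hq).2.1⟩) hs
    obtain ⟨hx, hy, w, hw, hwM⟩ := hsM _ hq
    dsimp only at hxn hyn hxy hyx hx hy hwM
    have hf : KCn U (f n x y) n + α ≤ m n + c₁ := by
      have := hc₁ _ _ _ hwM
      rw [hw] at this
      change KC U (f n x y) n.bits + α ≤ _
      omega
    have hxU : KCn U x n ≤ n + c₂ := hx ▸ hc₂ x _ x (Part.mem_some _)
    have hyU : KCn U y n ≤ n + c₂ := hy ▸ hc₂ y _ y (Part.mem_some _)
    have hdep : dep U n x y ≤ α + (c₂ + 3 : ℕ) := by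
      refine max_le ?_ ?_ <;> push_cast <;> omega
    have hdep' : ((dep U n x y : ℤ) : ℝ) ≤ α + (c₂ + 3) := by exact_mod_cast hdep
    have hxn' : (n : ℝ) ≤ KCn U x n + α + 3 := by exact_mod_cast hxn
    have hyn' : (n : ℝ) ≤ KCn U y n + α + 3 := by exact_mod_cast hyn
    have hf' : (KCn U (f n x y) n : ℝ) + α ≤ m n + c₁ := by exact_mod_cast hf
    refine ⟨x, y, hx, hy, ?_, ?_, ?_, ?_⟩ <;> linarith
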